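/- Completeness: if a formula A of L(∀,□) is logically valid (true at every valuation and world of every universal structure 𝒜 ∈ 𝔘𝔆), then A ∈ FOL□. -/

import Mathlib

namespace FOLBoxPaper

/-- Formulas of the language L(∀,□): atoms `P_j(x₁,…,xₙ)` (predicate index and
list of variables), identity `x = y`, negation, implication, universal
quantification, and the modal operator □. Variables are natural numbers. -/
inductive Formula : Type
  | atom : ℕ → List ℕ → Formula
  | eq : ℕ → ℕ → Formula
  | neg : Formula → Formula
  | imp : Formula → Formula → Formula
  | all : ℕ → Formula → Formula
  | box : Formula → Formula

namespace Formula

/-- Conjunction, defined as usual. -/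
def and (A B : Formula) : Formula := neg (imp A (neg B))

/-- Disjunction, defined as usual. -/
def or (A B : Formula) : Formula := imp (neg A) B

/-- Biconditional, defined as usual. -/
def iff (A B : Formula) : Formula := (imp A B).and (imp B A)

/-- ◇A := ¬□¬A. -/
def dia (A : Formula) : Formula := neg (box (neg A))

/-- ∃xA := ¬∀x¬A. -/
def ex (x : ℕ) (A : Formula) : Formula := neg (all x (neg A))

/-- A formula is □-free when it contains no occurrence of □. -/
def BoxFree : Formula → Prop
  | atom _ _ => True
  | eq _ _ => True
  | neg A => BoxFree A
  | imp A B => BoxFree A ∧ BoxFree B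
  | all _ A => BoxFree A
  | box _ => False

/-- `FreeIn x A`: the variable x has at least one ∀□-free occurrence in A,
i.e. an occurrence that is neither in the scope of a quantifier binding x
nor in the scope of □. -/
def FreeIn (x : ℕ) : Formula → Prop
  | atom _ args => x ∈ args
  | eq a b => x = a ∨ x = b
  | neg A => FreeIn x A
  | imp A B => FreeIn x A ∨ FreeIn x B
  | all z A => z ≠ x ∧ FreeIn x A
  | box _ => False

/-- The ∀□-free substitution `A(y/x)`: replace every ∀□-free occurrence of x
in A by y (occurrences in the scope of □ or of a quantifier binding x are
left untouched). -/
def subst (A : Formula) (y x : ℕ) : Formula :=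
  match A with
  | atom j args => atom j (args.map fun z => if z = x then y else z)
  | eq a b => eq (if a = x then y else a) (if b = x then y else b)
  | neg A => neg (subst A y x)
  | imp A B => imp (subst A y x) (subst B y x)
  | all z A => if z = x then all z A else all z (subst A y x)
  | box A => box A

/-- `Substitutable y x A`: the variable y is substitutable for the ∀□-free
occurrences of x in A, i.e. y is not captured by a quantifier when it
replaces x. -/
def Substitutable (y x : ℕ) : Formula → Prop
  | atom _ _ => True
  | eq _ _ => True
  | neg A => Substitutable y x A
  | imp A B => Substitutable y x A ∧ Substitutable y x B
  | all z A => z = x ∨ ¬ FreeIn x A ∨ (z ≠ y ∧ Substitutable y x A)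
  | box _ => True

end Formula

open Formula

/-- A first-order structure with variable domains:
a nonempty set of possible worlds, a nonempty domain of objects for each
world, and a world-relative interpretation of the predicate symbols. -/
structure Structure where
  W : Type
  wNonempty : Nonempty W
  D : W → Type
  dNonempty : ∀ w, Nonempty (D w)
  I : ℕ → (w : W) → List (D w) → Prop

/-- A valuation assigns, to each variable and world, an object of the domain
of that world. -/
def Valuation (M : Structure) : Type := ℕ → (w : M.W) → M.D w

open Classical in
/-- The variant `v^a_x(w)` of a valuation v at world w: it maps x at w to a
and agrees with v everywhere else. -/
noncomputable def updateVal {M : Structure} (v : Valuation M) (x : ℕ)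
    (w : M.W) (a : M.D w) : Valuation M :=
  fun y w' => if h : y = x ∧ w' = w then cast (congrArg M.D h.2.symm) a else v y w'

/-- Satisfaction `M, v, w ⊨ A`. The clause for □ quantifies over all
valuations and all worlds of the structure. -/
def Sat (M : Structure) : Valuation M → M.W → Formula → Prop
  | v, w, .atom j args => M.I j w (args.map fun z => v z w)
  | v, w, .eq a b => v a w = v b w
  | v, w, .neg A => ¬ Sat M v w A
  | v, w, .imp A B => Sat M v w A → Sat M v w B
  | v, w, .all x A => ∀ a : M.D w, Sat M (updateVal v x w a) w A
  | _, _, .box A => ∀ (v' : Valuation M) (w' : M.W), Sat M v' w' A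

/-- `M ⊨ A`: A is satisfied at every valuation and world of M. -/
def Models (M : Structure) (A : Formula) : Prop := ∀ v w, Sat M v w A

/-- Universal structures: M is universal when every □-free formula true
everywhere in M is true everywhere in every structure. -/
def Universal (M : Structure) : Prop :=
  ∀ B, BoxFree B → Models M B → ∀ N : Structure, Models N B

/-- Logical validity: truth at every valuation and world of every universal
structure. -/
def Valid (A : Formula) : Prop :=
  ∀ M : Structure, Universal M → ∀ (v : Valuation M) (w : M.W), Sat M v w A

/-- FOL: the set of □-free classical first-order theses, i.e. □-free formulas
satisfied at every valuation and world of every structure. -/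
def FOL : Set Formula := {A | BoxFree A ∧ ∀ M : Structure, Models M A}

/-- `PropTaut A`: A is an instantiation of a tautology of classical
propositional logic (it is true under every assignment of truth values to
formulas that respects ¬ and →). -/
def PropTaut (A : Formula) : Prop :=
  ∀ f : Formula → Prop,
    (∀ B, f (neg B) ↔ ¬ f B) → (∀ B C, f (imp B C) ↔ (f B → f C)) → f A

/-- The system FOL□. -/
inductive FOLBox : Formula → Prop
  | taut {A} : PropTaut A → FOLBox A
  | axK {A B} : FOLBox ((box (A.imp B)).imp ((box A).imp (box B)))
  | axT {A} : FOLBox ((box A).imp A)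
  | ax5 {A} : FOLBox ((neg (box A)).imp (box (neg (box A))))
  | axAll1 {A : Formula} {x y : ℕ} : Substitutable y x A →
      FOLBox ((all x A).imp (A.subst y x))
  | axAll2 {A B : Formula} {x : ℕ} : ¬ FreeIn x A →
      FOLBox ((all x (A.imp B)).imp (A.imp (all x B)))
  | axId {x : ℕ} : FOLBox (Formula.eq x x)
  | axEq {A : Formula} {x y : ℕ} : BoxFree A → Substitutable y x A →
      FOLBox (((Formula.eq x y).and A).imp (A.subst y x))
  | axMix {A : Formula} {x : ℕ} : FOLBox ((box A).imp (all x A))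
  | axBang {A} : BoxFree A → A ∉ FOL → FOLBox (neg (box A))
  | mp {A B} : FOLBox (A.imp B) → FOLBox A → FOLBox B
  | nec {A} : FOLBox A → FOLBox (box A)

/-- The conjunction of a (nonempty) finite list of formulas. -/
def conjList : List Formula → Formula
  | [] => Formula.eq 0 0
  | [A] => A
  | A :: B :: rest => A.and (conjList (B :: rest))

/-- FOL□-consistency: no finite conjunction of members of Γ has its negation
in FOL□. -/
def Consistent (Γ : Set Formula) : Prop :=
  ∀ L : List Formula, L ≠ [] → (∀ B ∈ L, B ∈ Γ) → ¬ FOLBox (neg (conjList L))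

/-- Maximal FOL□-consistency. -/
def MaxConsistent (Γ : Set Formula) : Prop :=
  Consistent Γ ∧ ∀ A, A ∈ Γ ∨ neg A ∈ Γ

/-- ∃-saturation: whenever ¬∀xA ∈ Γ there is a variable y with
¬A(y/x) ∈ Γ via a ∀□-free substitution. -/
def Saturated (Γ : Set Formula) : Prop :=
  ∀ (x : ℕ) (A : Formula), neg (all x A) ∈ Γ →
    ∃ y : ℕ, Substitutable y x A ∧ neg (A.subst y x) ∈ Γ

/-- MC: the family of all ∃-saturated maximal FOL□-consistent sets. -/
def MC : Set (Set Formula) := {Γ | Saturated Γ ∧ MaxConsistent Γ}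

/-- An elementary disjunction: a formula of the form
`A ∨ ◇B ∨ □C₁ ∨ … ∨ □Cₙ` with A, B, C₁, …, Cₙ □-free. -/
def ElemDisj (D : Formula) : Prop :=
  ∃ (A B : Formula) (Cs : List Formula),
    BoxFree A ∧ BoxFree B ∧ (∀ C ∈ Cs, BoxFree C) ∧
    D = (Cs.map Formula.box).foldl Formula.or (A.or B.dia)

/-- A conjunctive form: a conjunction of elementary disjunctions. -/
def ConjForm (F : Formula) : Prop :=
  ∃ Ds : List Formula, Ds ≠ [] ∧ (∀ D ∈ Ds, ElemDisj D) ∧ F = conjList Ds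

/-- The worlds of the canonical structure: members of MC. -/
def MCW : Type := {Γ : Set Formula // Γ ∈ MC}

/-- The relation ∼_Γ on variables: x ∼_Γ y iff the formula x = y belongs
to Γ. -/
def canonRel (Γ : MCW) (x y : ℕ) : Prop := Formula.eq x y ∈ Γ.val

/-- The canonical structure 𝒜^MC: worlds are the members of MC, the domain
of a world Γ consists of the classes [x]_{∼_Γ} of variables, and a predicate
holds of such classes iff the corresponding atomic formula belongs to Γ. -/
noncomputable def canonicalStructure (h : Nonempty MCW) : Structure where
  W := MCW
  wNonempty := h
  D := fun Γ => Quot (canonRel Γ)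
  dNonempty := fun Γ => ⟨Quot.mk _ 0⟩
  I := fun j Γ ds =>
    ∃ xs : List ℕ, ds = xs.map (Quot.mk (canonRel Γ)) ∧ Formula.atom j xs ∈ Γ.val

/-- The canonical valuation v^MC: v^MC(x, Γ) = [x]_{∼_Γ}. -/
noncomputable def canonicalVal (h : Nonempty MCW) : Valuation (canonicalStructure h) :=
  fun x Γ => Quot.mk (canonRel Γ) x

/-! ### Classical first-order satisfaction -/

/-- Satisfaction of a formula in a classical first-order structure with domain `D`.
Boxed formulas are irrelevant here and get the value `True`. -/
def FOSat {D : Type} (I : ℕ → List D → Prop) : (ℕ → D) → Formula → Prop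
  | s, .atom j args => I j (args.map s)
  | s, .eq a b => s a = s b
  | s, .neg A => ¬ FOSat I s A
  | s, .imp A B => FOSat I s A → FOSat I s B
  | s, .all x A => ∀ a : D, FOSat I (Function.update s x a) A
  | _, .box _ => True

theorem updateVal_same_world {M : Structure} (v : Valuation M) (x : ℕ) (w : M.W) (a : M.D w) :
    (fun y => updateVal v x w a y w) = Function.update (fun y => v y w) x a := by
  funext y
  by_cases h : y = x
  · subst h; simp [updateVal]
  · simp [updateVal, h]

theorem sat_iff_foSat {M : Structure} {A : Formula} (hA : BoxFree A) (v : Valuation M) (w : M.W) :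
    Sat M v w A ↔ FOSat (fun j => M.I j w) (fun x => v x w) A := by
  induction A generalizing v with
  | atom j args => rfl
  | eq a b => rfl
  | neg A ih => exact not_congr (ih hA v)
  | imp A B ihA ihB => exact imp_congr (ihA hA.1 v) (ihB hA.2 v)
  | all x A ih =>
    refine forall_congr' fun a => ?_
    rw [ih hA, updateVal_same_world]
  | box A => exact hA.elim

theorem foSat_congr {D : Type} (I : ℕ → List D → Prop) {A : Formula} {s t : ℕ → D}
    (h : ∀ x, FreeIn x A → s x = t x) : FOSat I s A ↔ FOSat I t A := by
  induction A generalizing s t with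
  | atom j args =>
    have : args.map s = args.map t := List.map_congr_left h
    simp only [FOSat, this]
  | eq a b => simp only [FOSat, h a (Or.inl rfl), h b (Or.inr rfl)]
  | neg A ih => exact not_congr (ih h)
  | imp A B ihA ihB =>
    exact imp_congr (ihA fun x hx => h x (Or.inl hx)) (ihB fun x hx => h x (Or.inr hx))
  | all z A ih =>
    refine forall_congr' fun a => ih fun x hx => ?_
    by_cases hz : x = z
    · subst hz; simp
    · simpa [hz] using h x ⟨fun e => hz e.symm, hx⟩
  | box A => rfl

/-! ### Syntactic facts about substitution -/

theorem subst_of_not_freeIn {A : Formula} {x y : ℕ} (h : ¬ FreeIn x A) : A.subst y x = A := by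
  induction A with
  | atom j args =>
    simp only [Formula.subst, Formula.atom.injEq, true_and]
    conv_rhs => rw [← List.map_id args]
    exact List.map_congr_left fun z hz => if_neg fun (e : z = x) => h (e ▸ hz)
  | eq a b =>
    simp only [FreeIn, not_or] at h
    simp [Formula.subst, Ne.symm h.1, Ne.symm h.2]
  | neg A ih => simp [Formula.subst, ih h]
  | imp A B ihA ihB =>
    simp only [FreeIn, not_or] at h
    simp [Formula.subst, ihA h.1, ihB h.2]
  | all z A ih =>
    by_cases hz : z = x
    · simp [Formula.subst, hz]
    · simp [Formula.subst, hz, ih fun hx => h ⟨hz, hx⟩]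
  | box A => rfl

theorem subst_self (A : Formula) (x : ℕ) : A.subst x x = A := by
  have key : ∀ z : ℕ, (if z = x then x else z) = z := fun z => by
    split_ifs with h <;> simp [h]
  induction A with
  | atom j args => simp only [Formula.subst, key, List.map_id']
  | all z A ih => simp [Formula.subst, ih]
  | _ => simp_all [Formula.subst]

theorem substitutable_self (A : Formula) (x : ℕ) : Substitutable x x A := by
  induction A with
  | all z A ih =>
    by_cases h : z = x
    · exact Or.inl h
    · exact Or.inr (Or.inr ⟨h, ih⟩)
  | imp A B ihA ihB => exact ⟨ihA, ihB⟩
  | neg A ih => exact ih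
  | _ => trivial

theorem boxFree_subst {A : Formula} (h : BoxFree A) (y x : ℕ) : BoxFree (A.subst y x) := by
  induction A with
  | all z A ih =>
    unfold Formula.subst
    split_ifs
    · exact h
    · exact ih h
  | imp A B ihA ihB => exact ⟨ihA h.1, ihB h.2⟩
  | neg A ih => exact ih h
  | box A => exact h
  | _ => trivial

theorem foSat_subst {D : Type} (I : ℕ → List D → Prop) {A : Formula} {x y : ℕ}
    (h : Substitutable y x A) (s : ℕ → D) :
    FOSat I s (A.subst y x) ↔ FOSat I (Function.update s x (s y)) A := by
  have key : ∀ (s : ℕ → D) (z : ℕ),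
      s (if z = x then y else z) = Function.update s x (s y) z := fun s z => by
    by_cases hz : z = x
    · subst hz; simp
    · simp [hz]
  induction A generalizing s with
  | atom j args =>
    simp only [Formula.subst, FOSat, List.map_map]
    rw [show (s ∘ fun z => if z = x then y else z) = Function.update s x (s y) from funext (key s)]
  | eq a b => simp only [Formula.subst, FOSat, key]
  | neg A ih => exact not_congr (ih h s)
  | imp A B ihA ihB => exact imp_congr (ihA h.1 s) (ihB h.2 s)
  | all z A ih =>
    by_cases hz : z = x
    · subst hz
      simp [Formula.subst, FOSat]
    rcases h with h | h | ⟨hzy, h⟩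
    · exact absurd h hz
    · have hfree : ¬ FreeIn x (all z A) := fun hx => h hx.2
      rw [subst_of_not_freeIn hfree]
      refine foSat_congr I fun u hu => ?_
      have : u ≠ x := by rintro rfl; exact hfree hu
      simp [this]
    · simp only [Formula.subst, if_neg hz, FOSat]
      refine forall_congr' fun a => ?_
      refine (ih h _).trans ?_
      rw [Function.update_comm hz, Function.update_of_ne (Ne.symm hzy)]
  | box A => rfl

/-- A strict upper bound for the variables occurring outside the scope of □. -/
def varBound : Formula → ℕ
  | .atom _ args => args.sum + 1
  | .eq a b => a + b + 1
  | .neg A => varBound A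
  | .imp A B => varBound A + varBound B
  | .all x A => x + 1 + varBound A
  | .box _ => 0

theorem not_freeIn_of_varBound_le {A : Formula} {y : ℕ} (h : varBound A ≤ y) : ¬ FreeIn y A := by
  induction A with
  | atom j args =>
    intro hy
    have := List.le_sum_of_mem hy
    simp only [varBound] at h
    omega
  | eq a b => simp only [varBound, FreeIn] at *; omega
  | neg A ih => exact ih h
  | imp A B ihA ihB =>
    simp only [varBound] at h
    exact not_or.2 ⟨ihA (by omega), ihB (by omega)⟩
  | all z A ih =>
    simp only [varBound] at h
    exact fun hy => ih (by omega) hy.2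
  | box A => exact id

theorem substitutable_of_varBound_le {A : Formula} {x y : ℕ} (h : varBound A ≤ y) :
    Substitutable y x A := by
  induction A with
  | neg A ih => exact ih h
  | imp A B ihA ihB =>
    simp only [varBound] at h
    exact ⟨ihA (by omega), ihB (by omega)⟩
  | all z A ih =>
    simp only [varBound] at h
    exact Or.inr (Or.inr ⟨by omega, ih (by omega)⟩)
  | _ => trivial

theorem subst_subst_of_varBound_le {A : Formula} {x y : ℕ} (h : varBound A ≤ y) :
    (A.subst y x).subst x y = A := by
  have key : ∀ z : ℕ, z ≠ y →
      (if (if z = x then y else z) = y then x else (if z = x then y else z)) = z := fun z hz => by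
    by_cases hx : z = x <;> simp [hx, hz]
  induction A with
  | atom j args =>
    have hy : ∀ z ∈ args, z ≠ y := by
      rintro z hz rfl
      exact not_freeIn_of_varBound_le h hz
    simp only [Formula.subst, List.map_map, Formula.atom.injEq, true_and]
    conv_rhs => rw [← List.map_id args]
    exact List.map_congr_left fun z hz => key z (hy z hz)
  | eq a b =>
    simp only [varBound] at h
    simp only [Formula.subst, key a (by omega), key b (by omega)]
  | neg A ih => simp only [Formula.subst, ih h]
  | imp A B ihA ihB =>
    simp only [varBound] at h
    simp only [Formula.subst, ihA (by omega), ihB (by omega)]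
  | all z A ih =>
    have hfree := not_freeIn_of_varBound_le h
    simp only [varBound] at h
    by_cases hz : z = x
    · rw [show (all z A).subst y x = all z A by simp [Formula.subst, hz],
        subst_of_not_freeIn hfree]
    · have hzy : z ≠ y := by omega
      simp only [Formula.subst, hz, hzy, if_false, ih (by omega)]
  | box A => rfl

theorem substitutable_subst_of_varBound_le {A : Formula} {x y : ℕ} (h : varBound A ≤ y) :
    Substitutable x y (A.subst y x) := by
  induction A with
  | neg A ih => exact ih h
  | imp A B ihA ihB =>
    simp only [varBound] at h
    exact ⟨ihA (by omega), ihB (by omega)⟩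
  | all z A ih =>
    simp only [varBound] at h
    by_cases hz : z = x
    · simp only [Formula.subst, if_pos hz]
      exact Or.inr (Or.inl (not_freeIn_of_varBound_le (by omega)))
    · simp only [Formula.subst, if_neg hz]
      exact Or.inr (Or.inr ⟨hz, ih (by omega)⟩)
  | _ => trivial

theorem not_freeIn_subst {A : Formula} {x y : ℕ} (h : x ≠ y) : ¬ FreeIn x (A.subst y x) := by
  have key : ∀ z : ℕ, (if z = x then y else z) ≠ x := fun z => by
    split_ifs with hz
    · exact h.symm
    · exact hz
  induction A with
  | atom j args =>
    simp only [Formula.subst, FreeIn, List.mem_map, not_exists, not_and]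
    exact fun z _ => key z
  | eq a b => exact not_or.2 ⟨(key a).symm, (key b).symm⟩
  | neg A ih => exact ih
  | imp A B ihA ihB => exact not_or.2 ⟨ihA, ihB⟩
  | all z A ih =>
    by_cases hz : z = x
    · simp [Formula.subst, hz, FreeIn]
    · simp only [Formula.subst, if_neg hz]
      exact fun hx => ih hx.2
  | box A => exact id

/-! ### Derivability in FOL□ -/

namespace FOLBox

theorem gen {A : Formula} (x : ℕ) (h : FOLBox A) : FOLBox (all x A) := mp axMix (nec h)

theorem imp_self (A : Formula) : FOLBox (A.imp A) :=
  taut fun f _ hi => by rw [hi]; exact id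

theorem weaken {A : Formula} (G : Formula) (h : FOLBox A) : FOLBox (G.imp A) :=
  mp (taut fun f _ hi => by simp only [hi]; tauto) h

theorem imp_mp {G A B : Formula} (h : FOLBox (G.imp (A.imp B))) (h' : FOLBox (G.imp A)) :
    FOLBox (G.imp B) :=
  mp (mp (taut fun f _ hi => by simp only [hi]; tauto) h) h'

theorem imp_trans {A B C : Formula} (h : FOLBox (A.imp B)) (h' : FOLBox (B.imp C)) :
    FOLBox (A.imp C) :=
  imp_mp (weaken A h') h

theorem imp_all {G A : Formula} {x : ℕ} (hx : ¬ FreeIn x G) (h : FOLBox (G.imp A)) :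
    FOLBox (G.imp (all x A)) :=
  mp (axAll2 hx) (gen x h)

theorem all_imp (A : Formula) (x : ℕ) : FOLBox ((all x A).imp A) := by
  simpa only [subst_self] using axAll1 (substitutable_self A x)

theorem all_mono {A B : Formula} (x : ℕ) (h : FOLBox (A.imp B)) :
    FOLBox ((all x A).imp (all x B)) :=
  imp_all (fun hx => hx.1 rfl) (imp_trans (all_imp A x) h)

theorem box_mono {A B : Formula} (h : FOLBox (A.imp B)) : FOLBox ((box A).imp (box B)) :=
  mp axK (nec h)

/-- Instantiation of a free variable of a theorem. -/
theorem subst {A : Formula} {x y : ℕ} (hs : Substitutable y x A) (h : FOLBox A) :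
    FOLBox (A.subst y x) :=
  mp (axAll1 hs) (gen x h)

theorem eq_imp {A : Formula} {x y : ℕ} (hA : BoxFree A) (hs : Substitutable y x A) :
    FOLBox ((Formula.eq x y).imp (A.imp (A.subst y x))) :=
  mp (taut fun f hn hi => by simp only [Formula.and, hn, hi]; tauto) (axEq hA hs)

/-- Replacement of a single argument of an atom by an equal one. -/
theorem eq_imp_atom (j : ℕ) (pre post : List ℕ) (x y : ℕ) :
    FOLBox ((Formula.eq x y).imp
      ((atom j (pre ++ x :: post)).imp (atom j (pre ++ y :: post)))) := by
  obtain ⟨u, hu⟩ : ∃ u, ∀ z ∈ y :: (pre ++ post), z ≠ u :=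
    ⟨(y :: (pre ++ post)).sum + 1, fun z hz => by have := List.le_sum_of_mem hz; omega⟩
  have hmap : ∀ (l : List ℕ) (t : ℕ), l ⊆ y :: (pre ++ post) →
      l.map (fun z => if z = u then t else z) = l := fun l t hl => by
    conv_rhs => rw [← List.map_id l]
    exact List.map_congr_left fun z hz => if_neg (hu z (hl hz))
  have hpre := fun t => hmap pre t (by simp)
  have hpost := fun t => hmap post t (by simp)
  have hy : y ≠ u := hu y (by simp)
  have h := subst (x := u) (y := x) (by simp [Formula.subst, Substitutable])
    (eq_imp (A := atom j (pre ++ u :: post)) (x := u) (y := y) trivial trivial)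
  simpa [Formula.subst, hpre, hpost, hy] using h

theorem eq_imp_eq_imp (x y z : ℕ) :
    FOLBox ((Formula.eq x y).imp ((Formula.eq x z).imp (Formula.eq y z))) := by
  obtain ⟨u, huy, huz⟩ : ∃ u, y ≠ u ∧ z ≠ u := ⟨y + z + 1, by omega, by omega⟩
  have h := subst (x := u) (y := x) (by simp [Formula.subst, Substitutable])
    (eq_imp (A := Formula.eq u z) (x := u) (y := y) trivial trivial)
  simpa [Formula.subst, huy, huz] using h

/-- Every object has a name `z` that is substitutable for `x` in `A`. -/
theorem not_all_imp_ne (A : Formula) {x y : ℕ} (h : y ≠ x) :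
    FOLBox (neg (all x ((A.imp A).imp (neg (Formula.eq x y))))) := by
  have h1 : FOLBox ((all x ((A.imp A).imp (neg (Formula.eq x y)))).imp
      (all x (neg (Formula.eq x y)))) :=
    all_mono x (taut fun f _ hi => by simp only [hi]; tauto)
  have h2 := axAll1 (A := neg (Formula.eq x y)) (x := x) (y := y) trivial
  have h3 : FOLBox (Formula.eq y y) := axId
  simp only [Formula.subst, if_true, if_neg h] at h2
  exact mp (mp (taut fun f hn hi => by simp only [hn, hi]; tauto) (imp_trans h1 h2)) h3

/-- Adjoining a fresh witness for a negated universal formula is conservative. -/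
theorem imp_all_of_fresh {G A : Formula} {x y : ℕ} (hG : varBound G ≤ y) (hx : x < y)
    (hA : varBound A ≤ y) (h : FOLBox (G.imp ((neg (all x A)).imp (A.subst y x)))) :
    FOLBox (G.imp (all x A)) := by
  have hfree : ¬ FreeIn y (G.and (neg (all x A))) :=
    not_or.2 ⟨not_freeIn_of_varBound_le hG, fun hy => not_freeIn_of_varBound_le hA hy.2⟩
  have h1 : FOLBox ((G.and (neg (all x A))).imp (all y (A.subst y x))) :=
    imp_all hfree (mp (taut fun f hn hi => by simp only [Formula.and, hn, hi]; tauto) h)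
  have h2 : FOLBox ((all y (A.subst y x)).imp (all x A)) := by
    refine imp_all (fun hf => not_freeIn_subst hx.ne hf.2) ?_
    simpa only [subst_subst_of_varBound_le hA] using
      axAll1 (substitutable_subst_of_varBound_le (x := x) hA)
  exact mp (taut fun f hn hi => by simp only [Formula.and, hn, hi]; tauto) (imp_trans h1 h2)

end FOLBox

/-! ### Henkin sets -/

/-- An injective numbering of formulas. -/
def Formula.code : Formula → ℕ
  | .atom j args => Nat.pair 0 (Nat.pair j (Encodable.encode args))
  | .eq a b => Nat.pair 1 (Nat.pair a b)
  | .neg A => Nat.pair 2 A.code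
  | .imp A B => Nat.pair 3 (Nat.pair A.code B.code)
  | .all x A => Nat.pair 4 (Nat.pair x A.code)
  | .box A => Nat.pair 5 A.code

theorem Formula.code_injective : Function.Injective Formula.code := by
  intro A
  induction A with
  | neg A ih | all x A ih | box A ih =>
    intro B h
    cases B <;> simp only [Formula.code, Nat.pair_eq_pair] at h <;> grind
  | imp A B ihA ihB =>
    intro C h
    cases C <;> simp only [Formula.code, Nat.pair_eq_pair] at h <;> grind
  | _ =>
    intro B h
    cases B <;> simp_all [Formula.code]

instance : Countable Formula := Formula.code_injective.countable

instance : Nonempty Formula := ⟨Formula.eq 0 0⟩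

/-- A consistent formula deciding `A` and, if it decides a universal formula `∀xB` negatively,
providing a witness for `¬B`. -/
theorem exists_henkin_step {G : Formula} (hG : ¬ FOLBox (neg G)) (A : Formula) :
    ∃ G' : Formula, ¬ FOLBox (neg G') ∧ FOLBox (G'.imp G) ∧
      (FOLBox (G'.imp A) ∨ FOLBox (G'.imp (neg A))) ∧
      ∀ x B, A = all x B → FOLBox (G'.imp (all x B)) ∨
        ∃ y, Substitutable y x B ∧ FOLBox (G'.imp (neg (B.subst y x))) := by
  by_cases h : FOLBox (G.imp A)
  · exact ⟨G, hG, FOLBox.imp_self G, Or.inl h, fun x B e => Or.inl (e ▸ h)⟩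
  by_cases hall : ∃ x B, A = all x B
  · obtain ⟨x, B, rfl⟩ := hall
    set y := varBound G + x + 1 + varBound B with hy
    refine ⟨(G.and (neg (all x B))).and (neg (B.subst y x)), fun hc => h ?_, ?_, Or.inr ?_, ?_⟩
    · refine FOLBox.imp_all_of_fresh (y := y) (by omega) (by omega) (by omega) ?_
      exact FOLBox.mp
        (FOLBox.taut fun f hn hi => by simp only [Formula.and, hn, hi]; tauto) hc
    · exact FOLBox.taut fun f hn hi => by simp only [Formula.and, hn, hi]; tauto
    · exact FOLBox.taut fun f hn hi => by simp only [Formula.and, hn, hi]; tauto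
    · intro x' B' e
      cases e
      exact Or.inr ⟨y, substitutable_of_varBound_le (by omega),
        FOLBox.taut fun f hn hi => by simp only [Formula.and, hn, hi]; tauto⟩
  · refine ⟨G.and (neg A), fun hc => h ?_, ?_, Or.inr ?_, fun x B e => (hall ⟨x, B, e⟩).elim⟩
    · exact FOLBox.mp
        (FOLBox.taut fun f hn hi => by simp only [Formula.and, hn, hi]; tauto) hc
    · exact FOLBox.taut fun f hn hi => by simp only [Formula.and, hn, hi]; tauto
    · exact FOLBox.taut fun f hn hi => by simp only [Formula.and, hn, hi]; tauto

/-- A deductively closed, negation complete, consistent and ∃-saturated set. -/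
structure IsHenkin (Γ : Set Formula) : Prop where
  thm : ∀ {A}, FOLBox A → A ∈ Γ
  mp : ∀ {A B}, A.imp B ∈ Γ → A ∈ Γ → B ∈ Γ
  neg_mem : ∀ {A}, neg A ∈ Γ ↔ A ∉ Γ
  saturated : Saturated Γ

theorem exists_isHenkin_mem {F : Formula} (hF : ¬ FOLBox (neg F)) :
    ∃ Γ : Set Formula, IsHenkin Γ ∧ F ∈ Γ := by
  obtain ⟨e, he⟩ := exists_surjective_nat Formula
  choose next hcons himp hdec hwit using
    fun (G : {G : Formula // ¬ FOLBox (neg G)}) (A : Formula) => exists_henkin_step G.2 A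
  let G : ℕ → {G : Formula // ¬ FOLBox (neg G)} :=
    fun n => Nat.rec ⟨F, hF⟩ (fun k H => ⟨next H (e k), hcons H (e k)⟩) n
  have hmono : ∀ {m n}, m ≤ n → FOLBox ((G n).1.imp (G m).1) := fun {m n} hmn => by
    induction hmn with
    | refl => exact FOLBox.imp_self _
    | step _ ih => exact FOLBox.imp_trans (himp _ _) ih
  have hcompl : ∀ A, (∃ n, FOLBox ((G n).1.imp A)) ∨ ∃ n, FOLBox ((G n).1.imp (neg A)) := by
    intro A
    obtain ⟨n, rfl⟩ := he A
    exact (hdec (G n) (e n)).imp (fun h => ⟨n + 1, h⟩) fun h => ⟨n + 1, h⟩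
  have hno : ∀ {A}, (∃ n, FOLBox ((G n).1.imp A)) → ¬ ∃ n, FOLBox ((G n).1.imp (neg A)) := by
    rintro A ⟨m, hm⟩ ⟨n, hn⟩
    have h1 := FOLBox.imp_trans (hmono (le_max_left m n)) hm
    have h2 := FOLBox.imp_trans (hmono (le_max_right m n)) hn
    exact (G (max m n)).2
      (.mp (.mp (.taut fun f hn hi => by simp only [hn, hi]; tauto) h1) h2)
  refine ⟨{A | ∃ n, FOLBox ((G n).1.imp A)}, ⟨fun h => ⟨0, FOLBox.weaken _ h⟩, ?_, ?_, ?_⟩,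
    0, FOLBox.imp_self F⟩
  · rintro A B ⟨m, hm⟩ ⟨n, hn⟩
    exact ⟨max m n, FOLBox.imp_mp (FOLBox.imp_trans (hmono (le_max_left m n)) hm)
      (FOLBox.imp_trans (hmono (le_max_right m n)) hn)⟩
  · exact fun {A} => ⟨fun h h' => hno h' h, fun h => (hcompl A).resolve_left h⟩
  · intro x A hA
    obtain ⟨n, hn⟩ := he (all x A)
    rcases hwit (G n) (e n) x A hn with h | ⟨y, hy, h⟩
    · exact (hno ⟨n + 1, h⟩ hA).elim
    · exact ⟨y, hy, n + 1, h⟩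

/-! ### The term model of a Henkin set -/

namespace IsHenkin

variable {Γ : Set Formula}

theorem eq_refl (h : IsHenkin Γ) (x : ℕ) : Formula.eq x x ∈ Γ := h.thm FOLBox.axId

theorem eq_symm (h : IsHenkin Γ) {x y : ℕ} (hxy : Formula.eq x y ∈ Γ) : Formula.eq y x ∈ Γ :=
  h.mp (h.mp (h.thm (FOLBox.eq_imp_eq_imp x y x)) hxy) (h.eq_refl x)

theorem eq_trans (h : IsHenkin Γ) {x y z : ℕ} (hxy : Formula.eq x y ∈ Γ)
    (hyz : Formula.eq y z ∈ Γ) : Formula.eq x z ∈ Γ :=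
  h.mp (h.mp (h.thm (FOLBox.eq_imp_eq_imp y x z)) (h.eq_symm hxy)) hyz

/-- Provable identity of variables. -/
def setoid (h : IsHenkin Γ) : Setoid ℕ where
  r x y := Formula.eq x y ∈ Γ
  iseqv := ⟨h.eq_refl, h.eq_symm, h.eq_trans⟩

/-- The interpretation of predicates in the term model. -/
def interp (h : IsHenkin Γ) (j : ℕ) (ds : List (Quotient h.setoid)) : Prop :=
  ∃ xs : List ℕ, xs.map (Quotient.mk h.setoid) = ds ∧ atom j xs ∈ Γ

theorem atom_mem_of_map_eq (h : IsHenkin Γ) (j : ℕ) (xs zs pre : List ℕ)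
    (he : xs.map (Quotient.mk h.setoid) = zs.map (Quotient.mk h.setoid))
    (hx : atom j (pre ++ xs) ∈ Γ) : atom j (pre ++ zs) ∈ Γ := by
  induction xs generalizing zs pre with
  | nil =>
    obtain rfl : zs = [] := by simpa using he.symm
    exact hx
  | cons x xs ih =>
    cases zs with
    | nil => simp at he
    | cons z zs =>
      simp only [List.map_cons, List.cons.injEq] at he
      have hxz : Formula.eq x z ∈ Γ := Quotient.exact he.1
      have := ih zs (pre ++ [z]) he.2
        (by simpa using h.mp (h.mp (h.thm (FOLBox.eq_imp_atom j pre xs x z)) hxz) hx)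
      simpa using this

theorem exists_substitutable_eq (h : IsHenkin Γ) (A : Formula) (x y : ℕ) :
    ∃ z, Substitutable z x A ∧ Formula.eq z y ∈ Γ := by
  by_cases hyx : y = x
  · exact ⟨x, substitutable_self A x, hyx ▸ h.eq_refl x⟩
  obtain ⟨z, hz, hmem⟩ := h.saturated _ _ (h.thm (FOLBox.not_all_imp_ne A hyx))
  refine ⟨z, hz.1.1, h.mp (h.thm ?_) hmem⟩
  simp only [Formula.subst, if_true, if_neg hyx]
  exact FOLBox.taut fun f hn hi => by simp only [hn, hi]; tauto

theorem imp_mem_iff (h : IsHenkin Γ) {A B : Formula} : A.imp B ∈ Γ ↔ (A ∈ Γ → B ∈ Γ) := by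
  refine ⟨h.mp, fun hAB => ?_⟩
  by_cases hA : A ∈ Γ
  · exact h.mp (h.thm (.taut fun f _ hi => by simp only [hi]; tauto)) (hAB hA)
  · exact h.mp (h.thm (.taut fun f hn hi => by simp only [hn, hi]; tauto)) (h.neg_mem.2 hA)

end IsHenkin

/-- The number of connectives and quantifiers outside the scope of □. -/
def Formula.depth : Formula → ℕ
  | .neg A => A.depth + 1
  | .imp A B => A.depth + B.depth + 1
  | .all _ A => A.depth + 1
  | _ => 0

theorem depth_subst (A : Formula) (y x : ℕ) : (A.subst y x).depth = A.depth := by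
  induction A with
  | all z A ih =>
    unfold Formula.subst
    split_ifs <;> simp [Formula.depth, ih]
  | _ => simp_all [Formula.subst, Formula.depth]

theorem IsHenkin.foSat_iff_mem {Γ : Set Formula} (h : IsHenkin Γ) (A : Formula)
    (hA : BoxFree A) : FOSat h.interp (Quotient.mk h.setoid) A ↔ A ∈ Γ := by
  induction hn : A.depth using Nat.strong_induction_on generalizing A with
  | _ n ih =>
  subst hn
  cases A with
  | atom j args =>
    refine ⟨?_, fun hm => ⟨args, rfl, hm⟩⟩
    rintro ⟨xs, hxs, hm⟩
    exact h.atom_mem_of_map_eq j xs args [] hxs hm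
  | eq a b => exact ⟨fun he => Quotient.exact he, fun hm => Quotient.sound hm⟩
  | neg A => exact (not_congr (ih _ (by simp [Formula.depth]) A hA rfl)).trans h.neg_mem.symm
  | imp A B =>
    refine Iff.trans (imp_congr (ih _ ?_ A hA.1 rfl) (ih _ ?_ B hA.2 rfl)) h.imp_mem_iff.symm <;>
      simp only [Formula.depth] <;> omega
  | all x A =>
    have key : ∀ y, Substitutable y x A →
        (FOSat h.interp (Function.update (Quotient.mk h.setoid) x (Quotient.mk h.setoid y)) A ↔
          A.subst y x ∈ Γ) := fun y hy => by
      rw [← foSat_subst h.interp hy]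
      exact ih _ (by simp [Formula.depth, depth_subst]) _ (boxFree_subst (A := A) hA y x) rfl
    constructor
    · intro hs
      by_contra hm
      obtain ⟨y, hy, hmem⟩ := h.saturated x A (h.neg_mem.2 hm)
      exact h.neg_mem.1 hmem ((key y hy).1 (hs _))
    · intro hm a
      obtain ⟨y, rfl⟩ := Quotient.exists_rep a
      obtain ⟨z, hz, hzy⟩ := h.exists_substitutable_eq A x y
      rw [← (Quotient.sound hzy : Quotient.mk h.setoid z = Quotient.mk h.setoid y)]
      exact (key z hz).2 (h.mp (h.thm (FOLBox.axAll1 hz)) hm)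
  | box A => exact hA.elim

/-- The structure with a single world given by a classical first-order structure. -/
def Structure.single {D : Type} [hD : Nonempty D] (I : ℕ → List D → Prop) : Structure where
  W := Unit
  wNonempty := ⟨()⟩
  D := fun _ => D
  dNonempty := fun _ => hD
  I := fun j _ => I j

/-- Completeness for first-order logic: FOL□ contains every classical first-order thesis. -/
theorem folBox_of_mem_FOL {A : Formula} (hA : A ∈ FOL) : FOLBox A := by
  by_contra hnot
  have hcons : ¬ FOLBox (neg (neg A)) := fun h =>
    hnot (.mp (.taut fun f hn hi => by simp only [hn, hi]; tauto) h)
  obtain ⟨Γ, hΓ, hmem⟩ := exists_isHenkin_mem hcons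
  have : Nonempty (Quotient hΓ.setoid) := ⟨Quotient.mk hΓ.setoid 0⟩
  have hsat := hA.2 (Structure.single hΓ.interp) (fun x _ => Quotient.mk hΓ.setoid x) ()
  exact hΓ.neg_mem.1 hmem ((hΓ.foSat_iff_mem A hA.1).1 ((sat_iff_foSat hA.1 _ _).1 hsat))

/-! ### Universal structures and elimination of □ -/

theorem exists_universal : ∃ M : Structure, Universal M := by
  have hex : ∀ B : {B : Formula // BoxFree B ∧ B ∉ FOL},
      ∃ (N : Structure) (v : Valuation N) (w : N.W), ¬ Sat N v w B.1 := by
    rintro ⟨B, hB, hnot⟩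
    by_contra! hc
    exact hnot ⟨hB, hc⟩
  choose N v w hN using hex
  let M : Structure :=
    { W := {B : Formula // BoxFree B ∧ B ∉ FOL}
      wNonempty := ⟨neg (Formula.eq 0 0), trivial, fun h =>
        h.2 (Structure.single (D := Unit) fun _ _ => True) (fun _ _ => ()) () rfl⟩
      D := fun B => (N B).D (w B)
      dNonempty := fun B => (N B).dNonempty (w B)
      I := fun j B => (N B).I j (w B) }
  refine ⟨M, fun B hB hM => ?_⟩
  by_contra hnot
  let b : M.W := ⟨B, hB, fun h => hnot h.2⟩
  exact hN b ((sat_iff_foSat hB _ _).2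
    ((sat_iff_foSat hB (fun x B' => v B' x (w B') : Valuation M) b).1 (hM _ _)))

open Classical in
/-- Replace every boxed subformula by a truth value, according to whether the result of
eliminating □ from its body is a first-order thesis. -/
noncomputable def elimBox : Formula → Formula
  | .atom j args => .atom j args
  | .eq a b => .eq a b
  | .neg A => .neg (elimBox A)
  | .imp A B => .imp (elimBox A) (elimBox B)
  | .all x A => .all x (elimBox A)
  | .box A => if elimBox A ∈ FOL then Formula.eq 0 0 else neg (Formula.eq 0 0)

theorem boxFree_elimBox (A : Formula) : BoxFree (elimBox A) := by
  induction A with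
  | box A => unfold elimBox; split_ifs <;> trivial
  | neg A ih => exact ih
  | imp A B ihA ihB => exact ⟨ihA, ihB⟩
  | all x A ih => exact ih
  | _ => trivial

theorem sat_elimBox_iff {M : Structure} (hM : Universal M) (A : Formula) (v : Valuation M)
    (w : M.W) : Sat M v w (elimBox A) ↔ Sat M v w A := by
  induction A generalizing v w with
  | atom j args => rfl
  | eq a b => rfl
  | neg A ih => exact not_congr (ih v w)
  | imp A B ihA ihB => exact imp_congr (ihA v w) (ihB v w)
  | all x A ih => exact forall_congr' fun a => ih _ w
  | box A ih =>
    have hbox : Sat M v w (box A) ↔ elimBox A ∈ FOL := by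
      refine ⟨fun h => ⟨boxFree_elimBox A, hM _ (boxFree_elimBox A) fun v' w' => ?_⟩,
        fun h v' w' => (ih v' w').1 (h.2 M v' w')⟩
      exact (ih v' w').2 (h v' w')
    rw [hbox, elimBox]
    split_ifs with h <;> simp [Sat, h]

theorem folBox_elimBox_iff (A : Formula) :
    FOLBox ((elimBox A).imp A) ∧ FOLBox (A.imp (elimBox A)) := by
  induction A with
  | atom j args => exact ⟨FOLBox.imp_self _, FOLBox.imp_self _⟩
  | eq a b => exact ⟨FOLBox.imp_self _, FOLBox.imp_self _⟩
  | neg A ih =>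
    exact ⟨.mp (.taut fun f hn hi => by simp only [elimBox, hn, hi]; tauto) ih.2,
      .mp (.taut fun f hn hi => by simp only [elimBox, hn, hi]; tauto) ih.1⟩
  | imp A B ihA ihB =>
    exact ⟨.mp (.mp (.taut fun f _ hi => by simp only [elimBox, hi]; tauto) ihA.2) ihB.1,
      .mp (.mp (.taut fun f _ hi => by simp only [elimBox, hi]; tauto) ihA.1) ihB.2⟩
  | all x A ih => exact ⟨FOLBox.all_mono x ih.1, FOLBox.all_mono x ih.2⟩
  | box A ih =>
    have hid : FOLBox (Formula.eq 0 0) := .axId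
    unfold elimBox
    split_ifs with h
    · exact ⟨FOLBox.weaken _ (.nec (.mp ih.1 (folBox_of_mem_FOL h))), FOLBox.weaken _ hid⟩
    · have hneg : FOLBox (neg (box (elimBox A))) := .axBang (boxFree_elimBox A) h
      exact ⟨.mp (.taut fun f hn hi => by simp only [hn, hi]; tauto) hid,
        .mp (.mp (.taut fun f hn hi => by simp only [hn, hi]; tauto) (FOLBox.box_mono ih.2)) hneg⟩

/-- Completeness: every logically valid formula is a theorem
of FOL□. -/
theorem completeness (A : Formula) (hA : Valid A) : FOLBox A := by
  obtain ⟨M, hM⟩ := exists_universal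
  have hmodels : Models M (elimBox A) := fun v w =>
    (sat_elimBox_iff hM A v w).2 (hA M hM v w)
  exact .mp (folBox_elimBox_iff A).1
    (folBox_of_mem_FOL ⟨boxFree_elimBox A, hM _ (boxFree_elimBox A) hmodels⟩)

end FOLBoxPaper
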